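/- arXiv:2511.01003 — 2 statements merged into one kernel-verified Lean document; each statement's English description precedes it below -/
import Mathlib

section
/- Let n ≥ 20 be an integer, q = 2^n (so q ≥ 2^{20}), and A, B, C, D, E ∈ 𝔽_{q²} such that neither condition (C1) nor condition (C2) holds, B = 0, and A C^q + D = 0. If A^{q+1} = 1, C^{q+1} = 1, and A E^q + E ≠ 0, then the Dillon hexanomial f_{A,B,C,D,E} is not APN. -/
/-- A function `f : F → F` is almost perfect nonlinear (APN) if for every nonzero `a`
and every `b`, the equation `f (x + a) + f x = b` has at most two solutions. -/
def IsAPN {F : Type*} [Field F] (f : F → F) : Prop :=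
  ∀ a b : F, a ≠ 0 → Set.ncard {x : F | f (x + a) + f x = b} ≤ 2

/-- The Dillon hexanomial `f_{A,B,C,D,E}(x) = A x³ + B x^{q+1} + C x^{2q+1} + D x^{q+2}
+ E x^{2q+2} + x^{3q}`. -/
def dillon {F : Type*} [Field F] (q : ℕ) (A B C D E : F) : F → F :=
  fun x => A * x ^ 3 + B * x ^ (q + 1) + C * x ^ (2 * q + 1) +
    D * x ^ (q + 2) + E * x ^ (2 * q + 2) + x ^ (3 * q)

/-- Condition (C1): `A ≠ 0`, `C = D = 0`, `A^q B = B^q`, `A^q E = E^q`. -/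
def CondC1 {F : Type*} [Field F] (q : ℕ) (A B C D E : F) : Prop :=
  A ≠ 0 ∧ C = 0 ∧ D = 0 ∧ A ^ q * B = B ^ q ∧ A ^ q * E = E ^ q

/-- Condition (C2): `A ≠ 0`, `C ≠ 0`, `D ≠ 0`, `A^{q+1} = 1`, `D = A C^q`,
`B^q = A^q B`, `E^q = A^q E`. -/
def CondC2 {F : Type*} [Field F] (q : ℕ) (A B C D E : F) : Prop :=
  A ≠ 0 ∧ C ≠ 0 ∧ D ≠ 0 ∧ A ^ (q + 1) = 1 ∧ D = A * C ^ q ∧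
    B ^ q = A ^ q * B ∧ E ^ q = A ^ q * E

/-- The key quantity `h₁` from the paper. -/
def h1Poly {F : Type*} [Field F] (q : ℕ) (A B C D : F) : F :=
  A ^ (q + 1) * B ^ (q + 1) + A * B ^ (2 * q) + A ^ q * B ^ 2 +
    B ^ 2 * C ^ q * D ^ q + B ^ (q + 1) * C ^ (q + 1) +
    B ^ (q + 1) * D ^ (q + 1) + B ^ (q + 1) + B ^ (2 * q) * C * D

/-- An instance of Hilbert's Theorem 90: an element of norm `1` has the form `a ^ (q - 1)`. -/
theorem exists_ne_zero_pow_eq_mul {F : Type*} [Field F] [CharP F 2] {q : ℕ} {C : F}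
    (hadd : ∀ x y : F, (x + y) ^ q = x ^ q + y ^ q) (hfrob : ∀ x : F, (x ^ q) ^ q = x)
    (hC : C ^ (q + 1) = 1) : ∃ a : F, a ≠ 0 ∧ a ^ q = C * a := by
  by_cases h : C = 1
  · exact ⟨1, one_ne_zero, by simp [h]⟩
  · refine ⟨1 + C ^ q, fun h0 => h ?_, ?_⟩
    · rw [← hfrob C, ← CharTwo.add_eq_zero.1 h0, one_pow]
    · rw [hadd, hfrob, one_pow]
      linear_combination -hC

/-- A field with `q ^ 2` elements contains an element of its subfield of `q` elements other than
`0` and `1`, provided `q > 2`. -/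
theorem exists_pow_eq_self_of_card_eq_sq {F : Type*} [Field F] [Fintype F] {q : ℕ} (hq : 2 < q)
    (hF : Fintype.card F = q ^ 2) : ∃ t : F, t ≠ 0 ∧ t ≠ 1 ∧ t ^ q = t := by
  obtain ⟨s, hs⟩ := IsCyclic.exists_generator (α := Fˣ)
  refine ⟨(s : F) ^ (q + 1), pow_ne_zero _ s.ne_zero, fun h => ?_, ?_⟩
  · have hord : orderOf s = q ^ 2 - 1 := by
      classical
      rw [orderOf_eq_card_of_forall_mem_zpowers hs, Nat.card_eq_fintype_card,
        Fintype.card_units, hF]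
    have hle := orderOf_le_of_pow_eq_one (Nat.succ_pos q)
      (Units.ext (by simpa using h) : s ^ (q + 1) = 1)
    have : q ^ 2 ≤ q + 2 := by omega
    nlinarith
  · have h := FiniteField.pow_card (s : F)
    rw [hF] at h
    calc ((s : F) ^ (q + 1)) ^ q = (s : F) ^ q ^ 2 * (s : F) ^ q := by ring
      _ = (s : F) ^ (q + 1) := by rw [h]; ring

/-- On the line `x ^ q = C * x` the hexanomial reduces to its degree-four term. -/
theorem dillon_eq_of_pow_eq_mul {F : Type*} [Field F] [CharP F 2] {q : ℕ} {A C D E x : F}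
    (hC : C ^ (q + 1) = 1) (hD : A * C ^ q = D) (hx : x ^ q = C * x) :
    dillon q A 0 C D E x = E * C ^ 2 * x ^ 4 := by
  have h2 : x ^ (2 * q) = (C * x) ^ 2 := by rw [mul_comm, pow_mul, hx]
  have h3 : x ^ (3 * q) = (C * x) ^ 3 := by rw [mul_comm, pow_mul, hx]
  simp only [dillon, pow_add, h2, h3, hx, ← hD]
  linear_combination (A * x ^ 3) * hC +
    (A * x ^ 3 + C ^ 3 * x ^ 3) * CharTwo.two_eq_zero (R := F)

theorem statement7 (n q : ℕ) (hn : 20 ≤ n) (hq : q = 2 ^ n)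
    (F : Type) [Field F] [Fintype F] (hF : Fintype.card F = q ^ 2)
    (A B C D E : F)
    (hC1 : ¬ CondC1 q A B C D E) (hC2 : ¬ CondC2 q A B C D E)
    (hB : B = 0) (hD : A * C ^ q + D = 0)
    (hA : A ^ (q + 1) = 1) (hC : C ^ (q + 1) = 1)
    (hE : A * E ^ q + E ≠ 0) :
    ¬ IsAPN (dillon q A B C D E) := by
  subst hB
  have hq4 : 4 ≤ q := hq ▸ (Nat.pow_le_pow_right two_pos (by omega : 2 ≤ n))
  have : CharP F 2 := by
    have h2 : ((Fintype.card F : ℕ) : F) = 0 := Nat.cast_card_eq_zero F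
    rw [hF, hq, ← pow_mul, Nat.cast_pow, Nat.cast_ofNat] at h2
    exact CharTwo.of_one_ne_zero_of_two_eq_zero one_ne_zero (pow_eq_zero_iff (by omega) |>.1 h2)
  have hadd (x y : F) : (x + y) ^ q = x ^ q + y ^ q := hq ▸ add_pow_char_pow x y 2 n
  have hfrob (x : F) : (x ^ q) ^ q = x := by
    rw [← pow_mul, ← sq, ← hF, FiniteField.pow_card]
  obtain ⟨a, ha, haC⟩ := exists_ne_zero_pow_eq_mul hadd hfrob hC
  obtain ⟨t, ht0, ht1, ht⟩ := exists_pow_eq_self_of_card_eq_sq (by omega) hF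
  have hDC : A * C ^ q = D := CharTwo.add_eq_zero.1 hD
  intro hAPN
  have key := hAPN a (E * C ^ 2 * a ^ 4) ha
  have hsub : {0, a, t * a} ⊆
      {x : F | dillon q A 0 C D E (x + a) + dillon q A 0 C D E x = E * C ^ 2 * a ^ 4} := by
    have hmem (x : F) (hx : x ^ q = C * x) :
        dillon q A 0 C D E (x + a) + dillon q A 0 C D E x = E * C ^ 2 * a ^ 4 := by
      rw [dillon_eq_of_pow_eq_mul hC hDC hx,
        dillon_eq_of_pow_eq_mul hC hDC (by rw [hadd, hx, haC, mul_add]),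
        show (x + a) ^ 4 = x ^ 4 + a ^ 4 from add_pow_char_pow x a 2 2]
      linear_combination (E * C ^ 2 * x ^ 4) * CharTwo.two_eq_zero (R := F)
    rintro x (rfl | rfl | rfl)
    · exact hmem _ (by rw [zero_pow (by omega), mul_zero])
    · exact hmem _ haC
    · exact hmem _ (by rw [mul_pow, ht, haC]; ring)
  have h3 : ({0, a, t * a} : Set F).ncard = 3 :=
    Set.ncard_eq_three.2 ⟨0, a, t * a, ha.symm, (mul_ne_zero ht0 ha).symm,
      fun h => ht1 (mul_right_cancel₀ ha (by rw [← h, one_mul])), rfl⟩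
  have := Set.ncard_le_ncard hsub (Set.toFinite _)
  omega
end

section
/- There exists a positive integer n₀ such that for every integer n ≥ n₀, setting q = 2^n, and for all A, B, C, D, E ∈ 𝔽_{q²} such that neither condition (C1) nor condition (C2) holds, B = E = 0, and A C^q + D ≠ 0: if the Dillon hexanomial f_{A,B,C,D,E} is APN, then one of the following holds: (i) A^{q+1} + C^{q+1} + D^{q+1} + 1 = 0 and (A C^q + D)^{q-1} = (A D^q + C)^{2(q-1)}; or (ii) A^{q+1} + C^{q+1} + D^{q+1} + 1 ≠ 0, C ≠ A D^q, and p₁·p₂ = 0, where p₁ := A^{q+2} C^q + A² D^{2q} + A^{q+1} D + A C^{2q+1} + A C^q D^{q+1} + A C^q + C² + C^{q+1} D + D^{q+2} + D, and p₂ := A^{2q+2} C^{q+1} + A^{q+1}(C^{q+1} D^{q+1} + C^{q+1} + D^{q+1} + D^{2q+2} + 1) + C^{3q+3} + C^{2q+2} + C^{q+1} D^{q+1} + D^{3q+3} + C^{2q+2} D^{q+1} + C^{q+1} D^{2q+2} + Tr(A^{q+2}(C D^{2q} + C^q D^q) + A² D^{3q} + A(C^{2q+1} D^q + C^{3q} +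 C^q D^{2q+1} + C^q D^q) + C² D^q), with Tr(z) := z + z^q. -/
section Auxiliary

open Polynomial

section FiniteFieldFacts

variable {F : Type*} [Field F]

theorem sum_pow_two_pow_sq_add_self [CharP F 2] (w : F) (n : ℕ) :
    ∑ i ∈ Finset.range n, (w ^ 2 + w) ^ 2 ^ i = w ^ 2 ^ n + w := by
  induction n with
  | zero => simp [CharTwo.add_self_eq_zero]
  | succ n ih =>
    rw [Finset.sum_range_succ, ih, add_pow_char_pow, ← pow_mul, ← pow_succ']
    linear_combination CharTwo.add_self_eq_zero (w ^ 2 ^ n)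

theorem eq_or_eq_add_one_of_sq_add_self_eq [CharP F 2] {x y : F} (h : x ^ 2 + x = y ^ 2 + y) :
    x = y ∨ x = y + 1 := by
  have h0 : (x + y) * (x + y + 1) = 0 := by grind
  rcases mul_eq_zero.mp h0 with h0 | h0
  · left; grind
  · right; grind

variable [Fintype F]

theorem card_units_pow_eq_one {d : ℕ} (hd : d ∣ Fintype.card F - 1) :
    Nat.card {x : Fˣ // x ^ d = 1} = d := by
  have h := IsCyclic.card_powMonoidHom_ker (G := Fˣ) d
  rw [Nat.card_units, Nat.card_eq_fintype_card (α := F), Nat.gcd_eq_right hd] at h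
  exact h

theorem card_filter_pow_eq_one [DecidableEq F] {d : ℕ} (hd0 : d ≠ 0)
    (hd : d ∣ Fintype.card F - 1) : (Finset.univ.filter fun x : F => x ^ d = 1).card = d := by
  rw [← Fintype.card_subtype, ← Nat.card_eq_fintype_card]
  refine (Nat.card_congr ?_).trans (card_units_pow_eq_one hd)
  exact
    { toFun := fun x => ⟨Units.ofPowEqOne x.1 d x.2 hd0, Units.pow_ofPowEqOne x.2 hd0⟩
      invFun := fun x => ⟨x.1.1, by rw [← Units.val_pow_eq_pow_val, x.2, Units.val_one]⟩
      left_inv := fun x => rfl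
      right_inv := fun x => by ext; rfl }

theorem exists_sq_add_self_eq [CharP F 2] {k : ℕ} (hk : Fintype.card F = 2 ^ (k + 1)) {x : F}
    (hx : ∑ i ∈ Finset.range (k + 1), x ^ 2 ^ i = 0) : ∃ w : F, w ^ 2 + w = x := by
  classical
  by_contra! hne
  let P : F[X] := ∑ i ∈ Finset.range (k + 1), X ^ 2 ^ i
  have hdeg : P.natDegree ≤ 2 ^ k := by
    refine natDegree_sum_le_of_forall_le _ _ fun i hi => ?_
    rw [natDegree_X_pow]
    exact Nat.pow_le_pow_right two_pos (Nat.lt_succ_iff.mp (Finset.mem_range.mp hi))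
  have heval (y : F) : P.eval y = ∑ i ∈ Finset.range (k + 1), y ^ 2 ^ i := by
    simp [P, eval_finsetSum]
  let S : Finset F := Finset.univ.image fun w : F => w ^ 2 + w
  have hS : 2 ^ k ≤ S.card := by
    have h := Finset.card_le_mul_card_image (f := fun w : F => w ^ 2 + w) Finset.univ 2
      fun b hb => by
        obtain ⟨y, -, rfl⟩ := Finset.mem_image.mp hb
        refine (Finset.card_le_card (t := {y, y + 1}) fun z hz => ?_).trans Finset.card_le_two
        simpa using eq_or_eq_add_one_of_sq_add_self_eq (Finset.mem_filter.mp hz).2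
    rw [Finset.card_univ, hk, pow_succ'] at h
    exact Nat.le_of_mul_le_mul_left h two_pos
  have hxS : x ∉ S := fun h => by
    obtain ⟨w, -, hw⟩ := Finset.mem_image.mp h
    exact hne w hw
  have hP : P = 0 := by
    refine eq_zero_of_natDegree_lt_card_of_eval_eq_zero' P (insert x S) (fun y hy => ?_) ?_
    · rw [heval]
      rcases Finset.mem_insert.mp hy with rfl | hy
      · exact hx
      · obtain ⟨w, -, rfl⟩ := Finset.mem_image.mp hy
        rw [sum_pow_two_pow_sq_add_self, ← hk, FiniteField.pow_card,
          CharTwo.add_self_eq_zero]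
    · rw [Finset.card_insert_of_notMem hxS]
      omega
  have hcoeff : P.coeff 1 = 1 := by
    simp only [P, finsetSum_coeff, coeff_X_pow]
    rw [Finset.sum_eq_single 0]
    · simp
    · intro i _ hi
      rw [if_neg]
      exact (Nat.one_lt_two_pow hi).ne
    · simp
  simp [hP] at hcoeff

/-- An element of the subfield with `2 ^ n` elements is of the form `w ^ 2 + w` in the quadratic
extension. -/
theorem exists_sq_add_self_eq_of_pow_eq [CharP F 2] {n : ℕ} (hn : n ≠ 0)
    (hcard : Fintype.card F = (2 ^ n) ^ 2) {x : F} (hx : x ^ 2 ^ n = x) :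
    ∃ w : F, w ^ 2 + w = x := by
  obtain ⟨k, hk⟩ : ∃ k, n + n = k + 1 := ⟨n + n - 1, by omega⟩
  refine exists_sq_add_self_eq (k := k) (by rw [hcard, ← hk]; ring) ?_
  rw [← hk, Finset.sum_range_add]
  simp only [pow_add, pow_mul, hx, CharTwo.add_self_eq_zero]

end FiniteFieldFacts

section TraceCoefficients

variable {F : Type*} [Field F]

theorem natDegree_sum_pow_two_pow_le {p : F[X]} {d m : ℕ} (hp : p.natDegree ≤ 2 * d) :
    (∑ i ∈ Finset.range m, p ^ 2 ^ i).natDegree ≤ d * 2 ^ m := by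
  refine natDegree_sum_le_of_forall_le _ _ fun i hi => ?_
  refine natDegree_pow_le.trans ?_
  have hi' : 2 ^ (i + 1) ≤ 2 ^ m :=
    Nat.pow_le_pow_right two_pos (Finset.mem_range.mp hi)
  calc 2 ^ i * p.natDegree ≤ 2 ^ i * (2 * d) := Nat.mul_le_mul_left _ hp
    _ = d * 2 ^ (i + 1) := by ring
    _ ≤ d * 2 ^ m := Nat.mul_le_mul_left _ hi'

variable [CharP F 2]

/-- If a quartic polynomial has absolute trace zero at almost all points of the field with
`4 * 2 ^ m` elements, then its cubic coefficient vanishes. -/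
theorem cubic_coeff_eq_zero_of_trace_eq_zero {m : ℕ} (hm : 16 ≤ 2 ^ m) {Z : Finset F}
    (hZ : 4 * 2 ^ m ≤ Z.card + 8) (hfix : ∀ z ∈ Z, z ^ (4 * 2 ^ m) = z) {a₀ a₁ a₂ a₃ a₄ : F}
    (h : ∀ z ∈ Z, ∑ i ∈ Finset.range (m + 2),
      (a₄ * z ^ 4 + a₃ * z ^ 3 + a₂ * z ^ 2 + a₁ * z + a₀) ^ 2 ^ i = 0) : a₃ = 0 := by
  let p : F[X] := C a₄ * X ^ 4 + C a₃ * X ^ 3 + C a₂ * X ^ 2 + C a₁ * X + C a₀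
  let Q : F[X] := ∑ i ∈ Finset.range m, p ^ 2 ^ i +
    (C (a₄ ^ 2 ^ m) * X + C (a₂ ^ 2 ^ m) * X ^ (2 * 2 ^ m) +
      C (a₁ ^ 2 ^ m) * X ^ 2 ^ m + C (a₀ ^ 2 ^ m)) +
    (C (a₄ ^ 2 ^ (m + 1)) * X ^ 2 + C (a₃ ^ 2 ^ (m + 1)) * X ^ (2 * 2 ^ m + 1) +
      C (a₂ ^ 2 ^ (m + 1)) * X + C (a₁ ^ 2 ^ (m + 1)) * X ^ (2 * 2 ^ m) + C (a₀ ^ 2 ^ (m + 1)))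
  have hQ : Q.natDegree ≤ 2 * 2 ^ m + 1 := by
    have hp : p.natDegree ≤ 2 * 2 := by
      simp only [p]
      compute_degree
    have h1 := (natDegree_sum_pow_two_pow_le (m := m) hp).trans (Nat.le_succ _)
    refine natDegree_add_le_of_degree_le (natDegree_add_le_of_degree_le h1 ?_) ?_
    · compute_degree
      all_goals omega
    · compute_degree
      all_goals omega
  have hP : Q + C (a₃ ^ 2 ^ m) * X ^ (3 * 2 ^ m) = 0 := by
    refine eq_zero_of_natDegree_lt_card_of_eval_eq_zero' _ Z (fun z hz => ?_)
      (Nat.lt_of_le_of_lt (m := 3 * 2 ^ m) (natDegree_add_le_of_degree_le (hQ.trans (by omega))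
        (natDegree_C_mul_X_pow_le _ _)) (by omega))
    have hz1 := hfix z hz
    have hz2 := h z hz
    have e (a : F) (k : ℕ) : a ^ (k * 2 ^ m) = (a ^ 2 ^ m) ^ k := by rw [mul_comm, pow_mul]
    have e' (a : F) (k : ℕ) : (a ^ k) ^ 2 ^ m = (a ^ 2 ^ m) ^ k := pow_right_comm _ _ _
    rw [Finset.sum_range_succ, Finset.sum_range_succ, pow_succ' 2 m, e _ 2] at hz2
    rw [e] at hz1
    simp only [Q, p, eval_add, eval_finsetSum, eval_mul, eval_pow, eval_C, eval_X, pow_succ' 2 m,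
      pow_succ z (2 * 2 ^ m), e]
    generalize ∑ i ∈ Finset.range m,
      (a₄ * z ^ 4 + a₃ * z ^ 3 + a₂ * z ^ 2 + a₁ * z + a₀) ^ 2 ^ i = S at hz2 ⊢
    simp only [add_pow_char_pow, mul_pow, e'] at hz2
    generalize z ^ 2 ^ m = w at hz1 hz2 ⊢
    grind
  have hc := congrArg (fun P : F[X] => P.coeff (3 * 2 ^ m)) hP
  have hQc : Q.coeff (3 * 2 ^ m) = 0 := coeff_eq_zero_of_natDegree_lt (hQ.trans_lt (by omega))
  simp only [coeff_add, coeff_C_mul_X_pow, coeff_zero, hQc, if_true, zero_add] at hc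
  exact pow_eq_zero_iff (by positivity) |>.mp hc

/-- Let `z` run over almost all points of a one-dimensional torus over the field with `4 * 2 ^ m`
elements. If `(k₀ + k₁ z + k₂ z² + k₃ z³ + k₄ z⁴) / z²` always has absolute trace zero,
then `k₁ ^ 2 = k₀`. -/
theorem torus_coeff_sq_eq {m : ℕ} (hm : 16 ≤ 2 ^ m) {Z : Finset F}
    (hZ : 4 * 2 ^ m ≤ Z.card + 8) (hZ0 : ∀ z ∈ Z, z ≠ 0) {s₁ s₂ s₃ : ℕ} {ρ₁ ρ₂ ρ₃ : F}
    (h₁ : 0 < s₁ ∧ s₁ ≤ 3 * 2 ^ m + 1 ∧ ∀ z ∈ Z, z ^ 2 ^ m = ρ₁ * z ^ s₁ * z ^ (2 * 2 ^ m))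
    (h₂ : 0 < s₂ ∧ s₂ ≤ 3 * 2 ^ m + 1 ∧ ∀ z ∈ Z, z ^ 2 ^ m * z ^ (4 * 2 ^ m) = ρ₂ * z ^ s₂)
    (h₃ : 0 < s₃ ∧ s₃ ≤ 3 * 2 ^ m + 1 ∧ ∀ z ∈ Z, z ^ 2 ^ m = ρ₃ * z ^ s₃ * z ^ (4 * 2 ^ m))
    {k₀ k₁ k₂ k₃ k₄ : F}
    (h : ∀ z ∈ Z, ∑ i ∈ Finset.range (m + 2),
      ((k₀ + k₁ * z + k₂ * z ^ 2 + k₃ * z ^ 3 + k₄ * z ^ 4) / z ^ 2) ^ 2 ^ i = 0) :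
    k₁ ^ 2 = k₀ := by
  obtain ⟨m, rfl⟩ : ∃ l, m = l + 1 := ⟨m - 1, by rcases m with _ | m <;> simp_all⟩
  obtain ⟨h₁0, h₁', h₁⟩ := h₁
  obtain ⟨h₂0, h₂', h₂⟩ := h₂
  obtain ⟨h₃0, h₃', h₃⟩ := h₃
  set r := 2 ^ (m + 1) with hr
  let p : F[X] := C k₀ + C k₁ * X + C k₂ * X ^ 2 + C k₃ * X ^ 3 + C k₄ * X ^ 4
  let S : F[X] := ∑ i ∈ Finset.range (m + 1), p ^ 2 ^ i * X ^ (r - 2 ^ (i + 1))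
  let T : F[X] := C (k₄ ^ r) * X ^ (3 * r) + C (k₃ ^ r) * X ^ (2 * r) + C (k₂ ^ r) * X ^ r +
    C (k₁ ^ r) + C (k₀ ^ r * ρ₁) * X ^ s₁
  let U : F[X] := C (k₄ ^ (2 * r) * ρ₂) * X ^ s₂ + C (k₃ ^ (2 * r)) * X ^ (3 * r) +
    C (k₂ ^ (2 * r)) * X ^ r + C (k₁ ^ (2 * r) * ρ₁) * X ^ s₁ + C (k₀ ^ (2 * r) * ρ₃) * X ^ s₃
  have hle {i : ℕ} (hi : i ∈ Finset.range (m + 1)) : 2 ^ (i + 1) ≤ r :=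
    Nat.pow_le_pow_right two_pos (Finset.mem_range.mp hi)
  have hS : S.natDegree ≤ 3 * r + 1 := by
    refine natDegree_sum_le_of_forall_le _ _ fun i hi => ?_
    have hp : p.natDegree ≤ 4 := by
      simp only [p]
      compute_degree
    refine natDegree_mul_le.trans ?_
    rw [natDegree_X_pow]
    have h1 := (natDegree_pow_le (p := p) (n := 2 ^ i)).trans (Nat.mul_le_mul_left _ hp)
    have h2 := hle hi
    rw [pow_succ] at h2 ⊢
    omega
  have hT : T.natDegree ≤ 3 * r + 1 := by
    simp only [T]
    compute_degree
    all_goals omega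
  have hU : U.natDegree ≤ 3 * r + 1 := by
    simp only [U]
    compute_degree
    all_goals omega
  have hP : S + T + U = 0 := by
    refine eq_zero_of_natDegree_lt_card_of_eval_eq_zero' _ Z (fun z hz => ?_)
      (Nat.lt_of_le_of_lt (m := 3 * r + 1)
        (natDegree_add_le_of_degree_le (natDegree_add_le_of_degree_le hS hT) hU) (by omega))
    have hz0 := hZ0 z hz
    have e (a : F) (k : ℕ) : a ^ (k * r) = (a ^ r) ^ k := by rw [mul_comm, pow_mul]
    have e' (a : F) (k : ℕ) : (a ^ k) ^ r = (a ^ r) ^ k := pow_right_comm _ _ _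
    have hz' := h z hz
    rw [Finset.sum_range_succ, Finset.sum_range_succ, pow_succ' 2 (m + 1), ← hr, e _ 2] at hz'
    have hSz : S.eval z = (∑ i ∈ Finset.range (m + 1),
        ((k₀ + k₁ * z + k₂ * z ^ 2 + k₃ * z ^ 3 + k₄ * z ^ 4) / z ^ 2) ^ 2 ^ i) * z ^ r := by
      simp only [S, p, eval_add, eval_finsetSum, eval_mul, eval_pow, eval_C, eval_X,
        Finset.sum_mul]
      refine Finset.sum_congr rfl fun i hi => ?_
      rw [div_pow, ← pow_mul, ← pow_succ', pow_sub₀ _ hz0 (hle hi)]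
      ring
    have h1 := h₁ z hz
    have h2 := h₂ z hz
    have h3 := h₃ z hz
    rw [e] at h1 h2 h3
    have hw : z ^ r ≠ 0 := pow_ne_zero _ hz0
    have hadd (a b : F) : (a + b) ^ r = a ^ r + b ^ r := by rw [hr, add_pow_char_pow]
    have h1' : ρ₁ * z ^ s₁ * z ^ r = 1 := mul_right_cancel₀ hw (by linear_combination -h1)
    have h3' : ρ₃ * z ^ s₃ * (z ^ r) ^ 3 = 1 := mul_right_cancel₀ hw (by linear_combination -h3)
    have hTz : T.eval z = ((k₀ + k₁ * z + k₂ * z ^ 2 + k₃ * z ^ 3 + k₄ * z ^ 4) / z ^ 2) ^ r *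
        z ^ r := by
      simp only [T, eval_add, eval_mul, eval_pow, eval_C, eval_X, e, div_pow, hadd, mul_pow, e']
      generalize z ^ r = w at *
      field_simp
      linear_combination k₀ ^ r * h1'
    have hUz : U.eval z =
        (((k₀ + k₁ * z + k₂ * z ^ 2 + k₃ * z ^ 3 + k₄ * z ^ 4) / z ^ 2) ^ r) ^ 2 * z ^ r := by
      simp only [U, eval_add, eval_mul, eval_pow, eval_C, eval_X, e, div_pow, hadd, mul_pow, e',
        CharTwo.add_sq]
      generalize z ^ r = w at *
      field_simp
      linear_combination (k₀ ^ r) ^ 2 * h3' + (k₁ ^ r) ^ 2 * w ^ 2 * h1' -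
        (k₄ ^ r) ^ 2 * w ^ 3 * h2
    rw [eval_add, eval_add, hSz, hTz, hUz, ← add_mul, ← add_mul, hz', zero_mul]
  have hS0 : S.eval 0 = k₀ ^ 2 ^ m := by
    simp only [S, p, eval_add, eval_finsetSum, eval_mul, eval_pow, eval_C, eval_X]
    rw [Finset.sum_range_succ, Finset.sum_eq_zero]
    · simp [hr]
    · intro i hi
      have : 2 ^ (i + 1) < r := Nat.pow_lt_pow_right one_lt_two (by simpa using hi)
      rw [zero_pow (Nat.sub_ne_zero_of_lt this), mul_zero]
  have h0 := congrArg (eval 0) hP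
  have hr0 : r ≠ 0 := by positivity
  simp only [T, U, eval_add, hS0, eval_mul, eval_pow, eval_C, eval_X, eval_zero,
    zero_pow h₁0.ne', zero_pow h₂0.ne', zero_pow h₃0.ne', zero_pow hr0,
    zero_pow (mul_ne_zero two_ne_zero hr0), zero_pow (mul_ne_zero three_ne_zero hr0), mul_zero,
    add_zero, zero_add] at h0
  rw [hr, pow_succ' 2 m, pow_mul, ← add_pow_char_pow, pow_eq_zero_iff (by positivity)] at h0
  exact (CharTwo.add_eq_zero.mp h0).symm

end TraceCoefficients

section Torus

variable {F : Type*} [Field F] [CharP F 2]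

/-- Both forms of a one-dimensional torus over the field with `4 * 2 ^ m` elements: the split form
`z ^ q = ρ * z` and the norm form `z ^ q * z = ρ`. -/
def IsTorus (m : ℕ) (Z : Finset F) (ρ : F) : Prop :=
  (∀ z ∈ Z, z ^ (4 * 2 ^ m) = ρ * z) ∨ ∀ z ∈ Z, z ^ (4 * 2 ^ m) * z = ρ

theorem IsTorus.coeff_one_sq_eq {m : ℕ} (hm : 16 ≤ 2 ^ m) {Z : Finset F}
    (hZ : 4 * 2 ^ m ≤ Z.card + 8) (hZ0 : ∀ z ∈ Z, z ≠ 0) {ρ : F} (hρ : ρ ≠ 0)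
    (hT : IsTorus m Z ρ) {k₀ k₁ k₂ k₃ k₄ : F}
    (h : ∀ z ∈ Z, ∑ i ∈ Finset.range (m + 2),
      ((k₀ + k₁ * z + k₂ * z ^ 2 + k₃ * z ^ 3 + k₄ * z ^ 4) / z ^ 2) ^ 2 ^ i = 0) :
    k₁ ^ 2 = k₀ := by
  obtain ⟨s, hs⟩ : ∃ s, 2 ^ m = s + 1 := ⟨2 ^ m - 1, by omega⟩
  rcases hT with hT | hT
  · refine torus_coeff_sq_eq (s₁ := 3 * 2 ^ m - 1) (s₂ := 2 ^ m + 1) (s₃ := s) (ρ₁ := ρ⁻¹)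
      (ρ₂ := ρ) (ρ₃ := ρ⁻¹) hm hZ hZ0 ⟨by omega, by omega, fun z hz => ?_⟩
      ⟨by omega, by omega, fun z hz => ?_⟩ ⟨by omega, by omega, fun z hz => ?_⟩ h
    · have hz := hT z hz
      have e : 3 * 2 ^ m - 1 + 2 * 2 ^ m = 4 * 2 ^ m + s := by omega
      rw [mul_assoc, ← pow_add, e, pow_add, hz, hs, pow_succ]
      field_simp
    · rw [hT z hz]
      ring
    · rw [hT z hz, hs, pow_succ]
      field_simp
  · refine torus_coeff_sq_eq (s₁ := 3 * 2 ^ m + 1) (s₂ := s) (s₃ := 2 ^ m + 1) (ρ₁ := ρ⁻¹)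
      (ρ₂ := ρ) (ρ₃ := ρ⁻¹) hm hZ hZ0 ⟨by omega, by omega, fun z hz => ?_⟩
      ⟨by omega, by omega, fun z hz => ?_⟩ ⟨by omega, by omega, fun z hz => ?_⟩ h
    · have := hZ0 z hz
      rw [← hT z hz]
      field_simp
      ring
    · rw [← hT z hz, hs, pow_succ]
      ring
    · have := hZ0 z hz
      rw [← hT z hz]
      field_simp
      ring

/-- If a Laurent polynomial of degrees between `-2` and `2` has absolute trace zero at almost all
points of a torus, then its outer coefficients are squares of their neighbours. -/
theorem IsTorus.coeff_sq_eq {m : ℕ} (hm : 16 ≤ 2 ^ m) {Z : Finset F}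
    (hZ : 4 * 2 ^ m ≤ Z.card + 8) (hZ0 : ∀ z ∈ Z, z ≠ 0) {ρ : F} (hρ : ρ ≠ 0)
    (hT : IsTorus m Z ρ) {k₀ k₁ k₂ k₃ k₄ : F}
    (h : ∀ z ∈ Z, ∑ i ∈ Finset.range (m + 2),
      ((k₀ + k₁ * z + k₂ * z ^ 2 + k₃ * z ^ 3 + k₄ * z ^ 4) / z ^ 2) ^ 2 ^ i = 0) :
    k₁ ^ 2 = k₀ ∧ k₃ ^ 2 = k₄ := by
  refine ⟨hT.coeff_one_sq_eq hm hZ hZ0 hρ h, ?_⟩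
  have hT' : IsTorus m (Z.map ⟨fun z : F => z⁻¹, inv_injective⟩) ρ⁻¹ := by
    refine hT.imp (fun hT y hy => ?_) fun hT y hy => ?_
    all_goals obtain ⟨z, hz, rfl⟩ := Finset.mem_map.mp hy
    · simp [hT z hz, mul_comm ρ⁻¹]
    · simp [inv_pow, ← hT z hz, mul_comm]
  refine hT'.coeff_one_sq_eq (k₂ := k₂) (k₃ := k₁) (k₄ := k₀) hm (by simpa using hZ)
    (fun y hy => ?_) (inv_ne_zero hρ) fun y hy => ?_
  all_goals obtain ⟨z, hz, rfl⟩ := Finset.mem_map.mp hy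
  · exact inv_ne_zero (hZ0 z hz)
  · rw [← h z hz]
    refine Finset.sum_congr rfl fun i _ => ?_
    congr 1
    have := hZ0 z hz
    simp only [Function.Embedding.coeFn_mk]
    field_simp
    ring

end Torus

section Derivative

variable {F : Type*} [Field F] [CharP F 2]

theorem IsAPN.eq_zero_or_eq_one [Finite F] {f : F → F} (hf : IsAPN f) (h0 : f 0 = 0) {a t : F}
    (ha : a ≠ 0) (h : f (a * t + a) + f (a * t) = f a) : t = 0 ∨ t = 1 := by
  by_contra! ht
  have hcard : ({0, a, a * t} : Set F).ncard = 3 := by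
    rw [Set.ncard_eq_three]
    refine ⟨0, a, a * t, ha.symm, (mul_ne_zero ha ht.1).symm, fun he => ht.2 ?_, rfl⟩
    exact mul_left_cancel₀ ha (by rw [← he, mul_one])
  have hsub : ({0, a, a * t} : Set F) ⊆ {x | f (x + a) + f x = f a} := by
    rintro x (rfl | rfl | rfl)
    · simp [h0]
    · simp [CharTwo.add_self_eq_zero, h0]
    · exact h
  have := (Set.ncard_le_ncard hsub (Set.toFinite _)).trans (hf a (f a) ha)
  omega

variable {q : ℕ} {σ : F →+* F} {A B C D : F}

omit [CharP F 2] in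
theorem dillon_eq (hσ : ∀ x, σ x = x ^ q) (x : F) :
    dillon q A 0 C D 0 x = A * x ^ 3 + C * σ x ^ 2 * x + D * σ x * x ^ 2 + σ x ^ 3 := by
  rw [dillon, hσ]
  ring

/-- Hilbert 90 for the involution `σ`. -/
theorem exists_map_eq_mul (hσσ : ∀ x, σ (σ x) = x) {u : F} (hu : u * σ u = 1) :
    ∃ a ≠ 0, σ a = u * a := by
  by_cases h : u = 1
  · exact ⟨1, one_ne_zero, by simp [h]⟩
  · refine ⟨1 + σ u, fun h1 => h ?_, ?_⟩
    · rw [CharTwo.add_eq_zero] at h1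
      rw [← hu, ← h1, mul_one]
    · rw [map_add, map_one, hσσ, mul_add, hu, mul_one, add_comm]

theorem IsAPN.eq_zero_or_eq_one_of_dillon [Finite F] (hσ : ∀ x, σ x = x ^ q)
    (hσσ : ∀ x, σ (σ x) = x) (hf : IsAPN (dillon q A 0 C D 0)) {u t : F} (hu : u * σ u = 1)
    (h : A * (t ^ 2 + t) + C * u ^ 2 * (σ t ^ 2 + t) + D * u * (σ t + t ^ 2) +
      u ^ 3 * (σ t ^ 2 + σ t) = 0) : t = 0 ∨ t = 1 := by
  obtain ⟨a, ha, hau⟩ := exists_map_eq_mul hσσ hu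
  refine hf.eq_zero_or_eq_one (by simp [dillon_eq hσ]) ha ?_
  simp only [dillon_eq hσ, map_add, map_mul, hau]
  generalize σ t = s at *
  grind

theorem derivative_numerator_eq_zero {a b d u v w : F} (huv : u * v = 1)
    {H M K L : F} (hH : H = A * a + C * b + D * d + 1)
    (hM : M = H + (b + D * a) * u + (C + A * d) * v)
    (hK : K = C * b + D * d + (b + D * a) * u + (a * C + d) * u ^ 2)
    (hL : L = C * b + D * d + (C + A * d) * v + (A * b + D) * v ^ 2)
    (hM0 : M ≠ 0) (hw : w ^ 2 + w = K * L / M ^ 2) :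
    A * ((K / M + w) ^ 2 + (K / M + w)) + C * u ^ 2 * ((L / M + w + 1) ^ 2 + (K / M + w)) +
      D * u * ((L / M + w + 1) + (K / M + w) ^ 2) +
      u ^ 3 * ((L / M + w + 1) ^ 2 + (L / M + w + 1)) = 0 := by
  have key : (A + D * u + C * u ^ 2 + u ^ 3) * (K * L) + A * (K ^ 2 + K * M) +
      C * u ^ 2 * (L ^ 2 + M ^ 2 + K * M) + D * u * (L * M + M ^ 2 + K ^ 2) +
      u ^ 3 * (L ^ 2 + L * M) = 0 := by
    have hu : u ≠ 0 := left_ne_zero_of_mul_eq_one huv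
    rw [eq_inv_of_mul_eq_one_right huv] at hM hL
    subst hM hH hK hL
    clear hw huv hM0
    field_simp
    grind
  field_simp at hw ⊢
  linear_combination key + (A + D * u + C * u ^ 2 + u ^ 3) * hw +
    (A * K * w * M + K * w * M * u * D + w * M * C * u ^ 2 * L + w * M * u ^ 3 * L +
      w * M ^ 2 * C * u ^ 2 + w * M ^ 2 * u ^ 3 + M * C * u ^ 2 * L + M * u ^ 3 * L +
      M ^ 2 * u ^ 3) * CharTwo.two_eq_zero (R := F)

theorem IsAPN.map_eq_self_of_dillon [Finite F] (hσ : ∀ x, σ x = x ^ q)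
    (hσσ : ∀ x, σ (σ x) = x) (hf : IsAPN (dillon q A 0 C D 0)) {H g h c : F}
    (hH : H = A * σ A + C * σ C + D * σ D + 1) (hg : g = σ C + D * σ A) (hh : h = σ A * C + σ D)
    (hc : c = C * σ C + D * σ D) {u : F} (hu : u * σ u = 1)
    (hM : H + g * u + σ g * σ u ≠ 0) (hN : H + h * u ^ 2 + σ h * σ u ^ 2 ≠ 0) {w : F}
    (hw : w ^ 2 + w = (c + g * u + h * u ^ 2) * (c + σ g * σ u + σ h * σ u ^ 2) /
      (H + g * u + σ g * σ u) ^ 2) : σ w = w := by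
  have hσg : σ g = C + A * σ D := by simp only [hg, map_add, map_mul, hσσ]; ring
  have hσh : σ h = A * σ C + D := by simp only [hh, map_add, map_mul, hσσ]
  have hσc : σ c = c := by simp only [hc, map_add, map_mul, hσσ]; ring
  have hσH : σ H = H := by simp only [hH, map_add, map_mul, hσσ, map_one]; ring
  set M := H + g * u + σ g * σ u with hMdef
  set K := c + g * u + h * u ^ 2 with hK
  set L := c + σ g * σ u + σ h * σ u ^ 2 with hL
  have hσM : σ M = M := by simp only [hMdef, map_add, map_mul, hσσ, hσH]; ring
  have hσK : σ K = L := by simp only [hK, hL, map_add, map_mul, map_pow, hσc]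
  have hσL : σ L = K := by simp only [hK, hL, map_add, map_mul, map_pow, hσc, hσσ]
  have hσw : σ w = w ∨ σ w = w + 1 := by
    refine eq_or_eq_add_one_of_sq_add_self_eq ?_
    rw [← map_pow, ← map_add, hw, map_div₀, map_mul, hσK, hσL, map_pow, hσM, mul_comm]
  refine hσw.resolve_right fun hσw => ?_
  have hσt : σ (K / M + w) = L / M + w + 1 := by
    rw [map_add, map_div₀, hσM, hσK, hσw, add_assoc]
  have ht := hf.eq_zero_or_eq_one_of_dillon hσ hσσ hu (t := K / M + w) <| by
    rw [hσt]
    exact derivative_numerator_eq_zero hu hH (by rw [hMdef, hσg, hg])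
      (by rw [hK, hc, hg, hh]) (by rw [hL, hc, hσg, hσh]) hM hw
  have ht' : σ (K / M + w) = K / M + w := by
    rcases ht with ht | ht <;> rw [ht] <;> simp
  rw [hσt] at ht'
  refine hN ?_
  field_simp at ht'
  grind

end Derivative

section GenericDirections

variable {F : Type*} [Field F]

/-- The invariants `H`, `g`, `h`, `c` of an APN Dillon hexanomial, together with almost all elements
`u` of norm one, at which the quotient `φ u` below is of the form `w ^ 2 + w` only for `w` in the
fixed field of `σ`. -/
structure GenericDirections (m : ℕ) (σ : F →+* F) (H g h c : F) (U : Finset F) : Prop where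
  le_two_pow : 16 ≤ 2 ^ m
  map_eq_pow : ∀ x, σ x = x ^ (4 * 2 ^ m)
  map_map : ∀ x, σ (σ x) = x
  map_H : σ H = H
  map_c : σ c = c
  norm_add_norm : g * σ g + h * σ h = c * (H + c)
  h_ne_zero : h ≠ 0
  le_card : 4 * 2 ^ m ≤ U.card + 8
  mul_map : ∀ u ∈ U, u * σ u = 1
  ne_zero : ∀ u ∈ U, H + g * u + σ g * σ u ≠ 0
  map_eq_self : ∀ u ∈ U, ∀ w, w ^ 2 + w = (c + g * u + h * u ^ 2) *
    (c + σ g * σ u + σ h * σ u ^ 2) / (H + g * u + σ g * σ u) ^ 2 → σ w = w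
  trace_eq_zero : ∀ u ∈ U, ∑ i ∈ Finset.range (m + 2), ((c + g * u + h * u ^ 2) *
    (c + σ g * σ u + σ h * σ u ^ 2) / (H + g * u + σ g * σ u) ^ 2) ^ 2 ^ i = 0

theorem exists_finset_mul_map_eq_one [Fintype F] {q : ℕ} {σ : F →+* F} (hσ : ∀ x, σ x = x ^ q)
    (hcard : Fintype.card F = q ^ 2) {H g h : F} (hh : h ≠ 0) (hgH : g ≠ 0 ∨ H ≠ 0) :
    ∃ U : Finset F, q ≤ U.card + 5 ∧ ∀ u ∈ U, u * σ u = 1 ∧ H + g * u + σ g * σ u ≠ 0 ∧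
      H + h * u ^ 2 + σ h * σ u ^ 2 ≠ 0 := by
  classical
  let P : F[X] := (C h * X ^ 4 + C H * X ^ 2 + C (σ h)) * (C g * X ^ 2 + C H * X + C (σ g))
  have hP : P ≠ 0 := by
    refine mul_ne_zero (fun h0 => hh ?_) fun h0 => ?_
    · simpa [coeff_X, coeff_C] using congrArg (fun p : F[X] => p.coeff 4) h0
    · refine hgH.elim (fun h1 => h1 ?_) fun h1 => h1 ?_
      · simpa [coeff_X, coeff_C] using congrArg (fun p : F[X] => p.coeff 2) h0
      · simpa [coeff_X, coeff_C] using congrArg (fun p : F[X] => p.coeff 1) h0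
  have hdeg : P.natDegree ≤ 6 := by
    simp only [P]
    compute_degree
  let V : Finset F := Finset.univ.filter fun u : F => u ^ (q + 1) = 1
  have hV : V.card = q + 1 := by
    refine card_filter_pow_eq_one q.succ_ne_zero ⟨q - 1, ?_⟩
    rw [hcard, ← Nat.sq_sub_sq, one_pow]
  refine ⟨V \ P.roots.toFinset, ?_, fun u hu => ?_⟩
  · have h1 := Finset.le_card_sdiff P.roots.toFinset V
    have h2 := (Multiset.toFinset_card_le P.roots).trans (P.card_roots'.trans hdeg)
    omega
  · rw [Finset.mem_sdiff, Multiset.mem_toFinset, mem_roots hP] at hu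
    have hu1 : u * σ u = 1 := by
      rw [hσ, ← pow_succ']
      exact (Finset.mem_filter.mp hu.1).2
    refine ⟨hu1, fun h0 => hu.2 ?_, fun h0 => hu.2 ?_⟩
    · have h2 : g * u ^ 2 + H * u + σ g = 0 := by linear_combination u * h0 - σ g * hu1
      simp [P, IsRoot, h2]
    · have h2 : h * u ^ 4 + H * u ^ 2 + σ h = 0 := by
        linear_combination u ^ 2 * h0 - σ h * (u * σ u + 1) * hu1
      simp [P, IsRoot, h2]

theorem IsAPN.exists_genericDirections [Fintype F] [CharP F 2] {m : ℕ} (hm : 16 ≤ 2 ^ m)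
    {σ : F →+* F} (hσ : ∀ x, σ x = x ^ (4 * 2 ^ m)) (hcard : Fintype.card F = (4 * 2 ^ m) ^ 2)
    {A C D : F} (hf : IsAPN (dillon (4 * 2 ^ m) A 0 C D 0)) {H g h c : F}
    (hH : H = A * σ A + C * σ C + D * σ D + 1) (hg : g = σ C + D * σ A) (hh : h = σ A * C + σ D)
    (hc : c = C * σ C + D * σ D) (hh0 : h ≠ 0) (hgH : g ≠ 0 ∨ H ≠ 0) :
    ∃ U : Finset F, GenericDirections m σ H g h c U := by
  have hσσ (x : F) : σ (σ x) = x := by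
    rw [hσ, hσ, ← pow_mul, ← sq, ← hcard, FiniteField.pow_card]
  have hσg : σ g = C + A * σ D := by simp only [hg, map_add, map_mul, hσσ]; ring
  have hσh : σ h = A * σ C + D := by simp only [hh, map_add, map_mul, hσσ]
  have hσc : σ c = c := by simp only [hc, map_add, map_mul, hσσ]; ring
  have hσH : σ H = H := by simp only [hH, map_add, map_mul, hσσ, map_one]; ring
  obtain ⟨U, hU, hU'⟩ := exists_finset_mul_map_eq_one hσ hcard hh0 hgH
  have hmap : ∀ u ∈ U, ∀ w, w ^ 2 + w = (c + g * u + h * u ^ 2) *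
      (c + σ g * σ u + σ h * σ u ^ 2) / (H + g * u + σ g * σ u) ^ 2 → σ w = w := fun u hu w hw =>
    hf.map_eq_self_of_dillon hσ hσσ hH hg hh hc (hU' u hu).1 (hU' u hu).2.1 (hU' u hu).2.2 hw
  refine ⟨U, hm, hσ, hσσ, hσH, hσc, ?_, hh0, hU.trans (by omega), fun u hu => (hU' u hu).1,
    fun u hu => (hU' u hu).2.1, hmap, fun u hu => ?_⟩
  · rw [hσg, hσh, hg, hh, hc, hH]
    grind
  · have h4 : 2 ^ (m + 2) = 4 * 2 ^ m := by ring
    obtain ⟨w, hw⟩ := exists_sq_add_self_eq_of_pow_eq (n := m + 2) (by omega)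
      (by rw [hcard, h4]) (x := (c + g * u + h * u ^ 2) *
        (c + σ g * σ u + σ h * σ u ^ 2) / (H + g * u + σ g * σ u) ^ 2) <| by
      rw [h4, ← hσ]
      simp only [map_div₀, map_mul, map_add, map_pow, hσσ, hσc, hσH]
      rw [mul_comm (c + σ g * σ u + _), add_right_comm H (σ g * σ u)]
    rw [← hw, sum_pow_two_pow_sq_add_self, h4, ← hσ, hmap u hu w hw, CharTwo.add_self_eq_zero]

namespace GenericDirections

variable [CharP F 2] {m : ℕ} {σ : F →+* F} {H g h c : F} {U : Finset F}

theorem g_ne_zero (hU : GenericDirections m σ H g h c U) (hH : H ≠ 0) : g ≠ 0 := by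
  rintro rfl
  have hne : ∀ u ∈ U, u ≠ 0 := fun u hu => left_ne_zero_of_mul_eq_one (hU.mul_map u hu)
  have hT : IsTorus m U 1 := Or.inr fun u hu => by
    rw [← hU.map_eq_pow, mul_comm, hU.mul_map u hu]
  have h0 := (hT.coeff_sq_eq hU.le_two_pow hU.le_card hne one_ne_zero (k₀ := c * σ h / H ^ 2)
    (k₁ := 0) (k₂ := (c ^ 2 + h * σ h) / H ^ 2) (k₃ := 0) (k₄ := c * h / H ^ 2)
    fun u hu => (Finset.sum_congr rfl fun i _ => ?_).trans (hU.trace_eq_zero u hu)).2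
  · have hc : c = 0 := by
      rw [eq_comm, zero_pow two_ne_zero] at h0
      simpa [hH, hU.h_ne_zero] using h0
    have h1 := hU.norm_add_norm
    simp [hc, hU.h_ne_zero] at h1
  · congr 1
    have hu0 := hne u hu
    rw [eq_inv_of_mul_eq_one_right (hU.mul_map u hu)]
    simp only [map_zero]
    field_simp
    ring

end GenericDirections

end GenericDirections

namespace GenericDirections

variable {F : Type*} [Field F] [Finite F] [CharP F 2] {m : ℕ} {σ : F →+* F} {H g h c : F}
  {U : Finset F}

theorem h_mul_sq_add_eq_zero (hU : GenericDirections m σ H g h c U) (hH : H = 0) (hg : g ≠ 0) :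
    h * σ g ^ 2 + σ h * g ^ 2 = 0 := by
  classical
  subst hH
  have hσg : σ g ≠ 0 := (map_ne_zero σ).mpr hg
  obtain ⟨u₀, hu₀⟩ := FiniteField.isSquare_of_char_two (ringChar.eq F 2) (σ g / g)
  have hu₀0 : u₀ ≠ 0 := by
    rintro rfl
    rw [mul_zero, div_eq_zero_iff] at hu₀
    exact hu₀.elim hσg hg
  have hσu₀ : u₀ * σ u₀ = 1 := by
    have h1 : (u₀ * σ u₀) ^ 2 = 1 := by
      rw [mul_pow, sq, ← map_pow, sq, ← hu₀, map_div₀, hU.map_map]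
      field_simp
    exact CharTwo.sq_inj.mp (h1.trans (one_pow 2).symm)
  have hgu : g * u₀ ^ 2 = σ g := by
    rw [sq, ← hu₀]
    field_simp
  let e : F → F := fun u => (u / u₀ + 1)⁻¹
  have he {u : F} (hu : u ∈ U) : u + u₀ ≠ 0 := fun h0 => hU.ne_zero u hu <| by
    rw [CharTwo.add_eq_zero.mp h0, eq_inv_of_mul_eq_one_right hσu₀, ← hgu]
    field_simp
    grind
  have he' {u : F} (hu : u ∈ U) : e u = u₀ / (u + u₀) := by
    have := he hu
    simp only [e]
    field_simp
  have hσe {u : F} (hu : u ∈ U) : σ (e u) = e u + 1 := by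
    have hu1 := hU.mul_map u hu
    have hu0 : u ≠ 0 := left_ne_zero_of_mul_eq_one hu1
    have h1 := he hu
    have h2 : u₀ + u ≠ 0 := by rwa [add_comm]
    rw [he' hu, map_div₀, map_add, eq_inv_of_mul_eq_one_right hσu₀,
      eq_inv_of_mul_eq_one_right hu1]
    field_simp
    grind
  have hinj : Set.InjOn e U := fun u _ v _ huv => by
    simpa [e, hu₀0, div_left_inj'] using huv
  set k := h * u₀ ^ 2 with hk
  set l := σ h / u₀ ^ 2 with hl
  set n := g * u₀ with hn
  have hn0 : n ≠ 0 := mul_ne_zero hg hu₀0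
  have hφ {u : F} (hu : u ∈ U) : (c + g * u + h * u ^ 2) * (c + σ g * σ u + σ h * σ u ^ 2) /
      (0 + g * u + σ g * σ u) ^ 2 = ((k + l) / n + c * (k + l) / n ^ 2) * e u ^ 4 +
        (k + l) / n * e u ^ 3 + (k + c) / n * e u ^ 2 + (k + c) / n * e u + c * k / n ^ 2 := by
    have hu1 := hU.mul_map u hu
    have hu0 : u ≠ 0 := left_ne_zero_of_mul_eq_one hu1
    have h1 := he hu
    have h2 := hU.norm_add_norm
    have h3 : 0 + g * u + σ g * σ u = g * (u + u₀) ^ 2 / u := by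
      rw [← hgu, eq_inv_of_mul_eq_one_right hu1]
      field_simp
      grind
    rw [h3, he' hu, eq_inv_of_mul_eq_one_right hu1, hk, hl, hn]
    rw [← hgu] at h2 ⊢
    generalize σ h = h' at *
    clear * - h1 h2 hg hu₀0 hu0
    field_simp
    grind
  obtain ⟨u₁, hu₁⟩ : U.Nonempty := by
    rw [← Finset.card_pos]
    have := hU.le_card
    have := hU.le_two_pow
    omega
  set s₁ := e u₁ with hs₁
  have h3 : (k + l) / n = 0 := by
    refine cubic_coeff_eq_zero_of_trace_eq_zero hU.le_two_pow (Z := U.image fun u => e u + s₁)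
      (a₄ := (k + l) / n + c * (k + l) / n ^ 2) (a₂ := (k + c) / n + (k + l) / n * s₁)
      (a₁ := (k + c) / n + (k + l) / n * s₁ ^ 2) (a₀ := ((k + l) / n + c * (k + l) / n ^ 2) *
        s₁ ^ 4 + (k + l) / n * s₁ ^ 3 + (k + c) / n * s₁ ^ 2 + (k + c) / n * s₁ + c * k / n ^ 2)
      ?_ (fun z hz => ?_) fun z hz => ?_
    · rw [Finset.card_image_of_injOn fun u hu v hv huv => hinj hu hv (add_right_cancel huv)]
      exact hU.le_card
    all_goals obtain ⟨u, hu, rfl⟩ := Finset.mem_image.mp hz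
    · rw [← hU.map_eq_pow, map_add, hσe hu, hs₁, hσe hu₁]
      grind
    · refine (Finset.sum_congr rfl fun i _ => ?_).trans (hU.trace_eq_zero u hu)
      rw [hφ hu]
      congr 1
      generalize c * (k + l) / n ^ 2 = x₁, (k + l) / n = x₂, (k + c) / n = x₃, c * k / n ^ 2 = x₄
      grind
  have h4 : k + l = 0 := by simpa [hn0] using h3
  rw [hk, hl] at h4
  rw [← hgu]
  field_simp at h4
  linear_combination g ^ 2 * h4

end GenericDirections

section Algebra

variable {F : Type*} [Field F] [CharP F 2] {H c η θ v w : F}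

theorem eta_dichotomy (hH : H ≠ 0) (hv : v ≠ 0) (hvw : w = v + 1) (hw : w ≠ 0)
    (hηθ : η * θ * (v * w) ^ 2 = c * (H + c) + H ^ 2 * (v * w))
    (h₀ : ((c + H * v + η * v ^ 2) * (v * w) + v ^ 2 * (c + H * w + θ * w ^ 2)) ^ 2 =
      (c + H * v + η * v ^ 2) * (v ^ 2 * (c + H * w + θ * w ^ 2)))
    (h₁ : ((c + H * w + η * w ^ 2) * (v * w) + w ^ 2 * (c + H * v + θ * v ^ 2)) ^ 2 =
      (c + H * w + η * w ^ 2) * (w ^ 2 * (c + H * v + θ * v ^ 2))) :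
    η = H ∨ η ≠ θ ∧ (v * w) ^ 2 * (η + θ) = c + H * (v * w) := by
  subst hvw
  have h₀' : (c + H * v + η * v ^ 2) ^ 2 * (v + 1) ^ 2 +
      v ^ 2 * (c + H * (v + 1) + θ * (v + 1) ^ 2) ^ 2 +
      (c + H * v + η * v ^ 2) * (c + H * (v + 1) + θ * (v + 1) ^ 2) = 0 :=
    mul_left_cancel₀ (pow_ne_zero 2 hv) (by
      linear_combination h₀ +
        (c + H * v + η * v ^ 2) * v ^ 2 * (c + H * (v + 1) + θ * (v + 1) ^ 2) *
        (1 - v * (v + 1)) * CharTwo.two_eq_zero (R := F))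
  have h₁' : (c + H * (v + 1) + η * (v + 1) ^ 2) ^ 2 * v ^ 2 +
      (v + 1) ^ 2 * (c + H * v + θ * v ^ 2) ^ 2 +
      (c + H * (v + 1) + η * (v + 1) ^ 2) * (c + H * v + θ * v ^ 2) = 0 :=
    mul_left_cancel₀ (pow_ne_zero 2 hw) (by
      linear_combination h₁ + (c + H * (v + 1) + η * (v + 1) ^ 2) * (v + 1) ^ 2 *
        (c + H * v + θ * v ^ 2) * (1 - v * (v + 1)) * CharTwo.two_eq_zero (R := F))
  clear h₀ h₁
  have h2 : (η + θ) * ((v * (v + 1)) ^ 2 * (η + θ) + (c + H * (v * (v + 1)))) = 0 := by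
    grind
  by_cases hS : η = θ
  · subst hS
    left
    have h3 : (c + H * (v * (v + 1))) * (H + η) = 0 := by
      grind
    have h4 : (v * (v + 1) * η) ^ 2 = (v * (v + 1) * H) ^ 2 := by
      rcases mul_eq_zero.mp h3 with h3 | h3
      · grind
      · rw [CharTwo.add_eq_zero.mp h3]
    exact mul_left_cancel₀ (mul_ne_zero hv hw) (CharTwo.sq_inj.mp h4)
  · refine Or.inr ⟨hS, ?_⟩
    rcases mul_eq_zero.mp h2 with h2 | h2
    · exact absurd (CharTwo.add_eq_zero.mp h2) hS
    · exact CharTwo.add_eq_zero.mp h2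

end Algebra

namespace GenericDirections

variable {F : Type*} [Field F] [CharP F 2] {m : ℕ} {σ : F →+* F} {H g h c : F} {U : Finset F}

theorem quotient_eq (hU : GenericDirections m σ H g h c U) (hH : H ≠ 0) (hg : g ≠ 0) {v w u : F}
    (hvw : w = v + 1) (hP : v * w = g * σ g / H ^ 2) (hu : u ∈ U) :
    g * u / H + v ≠ 0 ∧ g * u / H + w ≠ 0 ∧ σ (g * u / H) = v * w / (g * u / H) ∧
      (c + g * u + h * u ^ 2) * (c + σ g * σ u + σ h * σ u ^ 2) /
        (H + g * u + σ g * σ u) ^ 2 =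
      (c + H * (g * u / H) + h * (H / g) ^ 2 * (g * u / H) ^ 2) *
        (c * (g * u / H) ^ 2 + H * (v * w) * (g * u / H) +
          σ h * (H / σ g) ^ 2 * (v * w) ^ 2) /
        (H * ((g * u / H + v) * (g * u / H + w))) ^ 2 := by
  have hu1 := hU.mul_map u hu
  have hu0 : u ≠ 0 := left_ne_zero_of_mul_eq_one hu1
  have hσg : σ g ≠ 0 := (map_ne_zero σ).mpr hg
  have hM : H + g * u + σ g * σ u =
      H * ((g * u / H + v) * (g * u / H + w)) / (g * u / H) := by
    have h1 : (g * u / H + v) * (g * u / H + w) =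
        (g * u / H) ^ 2 + g * u / H + g * σ g / H ^ 2 := by
      rw [← hP]
      subst hvw
      grind
    rw [h1, eq_inv_of_mul_eq_one_right hu1]
    field_simp
    ring
  have h0 := hU.ne_zero u hu
  rw [hM] at h0
  have h1 : (g * u / H + v) * (g * u / H + w) ≠ 0 := fun h1 => h0 (by rw [h1]; simp)
  refine ⟨left_ne_zero_of_mul h1, right_ne_zero_of_mul h1, ?_, ?_⟩
  · rw [hP, map_div₀, map_mul, hU.map_H, eq_inv_of_mul_eq_one_right hu1]
    field_simp
  · rw [hM, hP, eq_inv_of_mul_eq_one_right hu1]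
    field_simp

theorem eq_zero_of_exceptional (hU : GenericDirections m σ H g h c U) (hH : H ≠ 0) (hg : g ≠ 0)
    {v w S : F} (hvw : w = v + 1) (hP : v * w = g * σ g / H ^ 2) (hσv : σ v = w)
    (hη : h * (H / g) ^ 2 = v ^ 2 * S + H) (hθ : σ h * (H / σ g) ^ 2 = w ^ 2 * S + H)
    (hc : c = (v * w) ^ 2 * S + H * (v * w)) : False := by
  subst hc
  obtain ⟨u, hu⟩ : U.Nonempty := by
    rw [← Finset.card_pos]
    have := hU.le_card
    have := hU.le_two_pow
    omega
  obtain ⟨h1, h2, hσy, hφ⟩ := hU.quotient_eq hH hg hvw hP hu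
  have hσw : σ w = v := by rw [← hσv, hU.map_map]
  have hu0 : u ≠ 0 := left_ne_zero_of_mul_eq_one (hU.mul_map u hu)
  have hσg : σ g ≠ 0 := (map_ne_zero σ).mpr hg
  have hvw0 : v * w ≠ 0 := by
    rw [hP]
    positivity
  have hv0 := left_ne_zero_of_mul hvw0
  have hw0 := right_ne_zero_of_mul hvw0
  have hσS : σ S = S := by
    have h3 := congrArg σ hη
    simp only [map_mul, map_pow, map_div₀, map_add, hU.map_H, hσv] at h3
    rw [hθ] at h3
    exact (mul_left_cancel₀ (pow_ne_zero 2 hw0) (add_right_cancel h3)).symm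
  have hy : g * u / H ≠ 0 := by positivity
  rw [hη, hθ] at hφ
  generalize g * u / H = y at *
  have h3 := hU.map_eq_self u hu (v + S * (v * w) * v / H * ((y + w) / (y + v))) <| by
    rw [hφ]
    field_simp
    grind
  have h4 : σ (v * ((y + w) / (y + v))) = v * ((y + w) / (y + v)) := by
    rw [map_mul, map_div₀, map_add, map_add, hσv, hσw, hσy]
    have e1 : v * w / y + v = v * (y + w) / y := by field_simp; ring
    have e2 : v * w / y + w = w * (y + v) / y := by field_simp; ring
    rw [e1, e2]
    field_simp
  have h5 : S * (v * w) * v / H * ((y + w) / (y + v)) =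
      S * (v * w) / H * (v * ((y + w) / (y + v))) := by ring
  rw [h5, map_add, map_mul, h4, map_div₀, map_mul, map_mul, hσS, hσv, hσw, hU.map_H,
    mul_comm w v] at h3
  have h6 := add_right_cancel h3
  grind

end GenericDirections

namespace GenericDirections

variable {F : Type*} [Field F] [CharP F 2] {m : ℕ} {σ : F →+* F} {H g h c : F} {U : Finset F}

theorem coeff_sq_eq (hU : GenericDirections m σ H g h c U) (hH : H ≠ 0) (hg : g ≠ 0) {v w η θ : F}
    (hvw : w = v + 1) (hP : v * w = g * σ g / H ^ 2) (hη : η = h * (H / g) ^ 2)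
    (hθ : θ = σ h * (H / σ g) ^ 2) :
    ((c + H * v + η * v ^ 2) * (v * w) + v ^ 2 * (c + H * w + θ * w ^ 2)) ^ 2 =
        (c + H * v + η * v ^ 2) * (v ^ 2 * (c + H * w + θ * w ^ 2)) ∧
      ((c + H * w + η * w ^ 2) * (v * w) + w ^ 2 * (c + H * v + θ * v ^ 2)) ^ 2 =
        (c + H * w + η * w ^ 2) * (w ^ 2 * (c + H * v + θ * v ^ 2)) := by
  classical
  have hσg : σ g ≠ 0 := (map_ne_zero σ).mpr hg
  have hvw0 : v * w ≠ 0 := by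
    rw [hP]
    positivity
  have hv0 := left_ne_zero_of_mul hvw0
  have hw0 := right_ne_zero_of_mul hvw0
  have hσP : σ (v * w) = v * w := by
    rw [hP, map_div₀, map_mul, hU.map_map, map_pow, hU.map_H, mul_comm]
  let e : F → F := fun u => 1 + (g * u / H + w)⁻¹
  have he {u : F} (hu : u ∈ U) : e u = (g * u / H + v) / (g * u / H + w) := by
    have h1 := (hU.quotient_eq hH hg hvw hP hu).2.1
    simp only [e]
    generalize g * u / H = y at *
    field_simp
    grind
  have hinj : Set.InjOn e U := fun u _ u' _ huu => by
    simpa [e, hg, hH, div_left_inj'] using huu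
  have hne : ∀ z ∈ U.image e, z ≠ 0 := fun z hz => by
    obtain ⟨u, hu, rfl⟩ := Finset.mem_image.mp hz
    have h1 := hU.quotient_eq hH hg hvw hP hu
    rw [he hu]
    exact div_ne_zero h1.1 h1.2.1
  have hT : ∃ ρ ≠ 0, IsTorus m (U.image e) ρ := by
    have hσv : σ v = v ∨ σ v = v + 1 := by
      refine eq_or_eq_add_one_of_sq_add_self_eq ?_
      have h1 : v ^ 2 + v = v * w := by rw [hvw]; ring
      rw [← map_pow, ← map_add, h1, hσP]
    have e1 {y : F} (hy : y ≠ 0) : v * w / y + v = v * (y + w) / y := by field_simp; ring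
    have e2 {y : F} (hy : y ≠ 0) : v * w / y + w = w * (y + v) / y := by field_simp; ring
    rcases hσv with hσv | hσv
    · have hσw : σ w = w := by rw [hvw, map_add, map_one, hσv]
      refine ⟨v / w, div_ne_zero hv0 hw0, Or.inr fun z hz => ?_⟩
      obtain ⟨u, hu, rfl⟩ := Finset.mem_image.mp hz
      obtain ⟨h1, h2, hσy, -⟩ := hU.quotient_eq hH hg hvw hP hu
      have hu0 : u ≠ 0 := left_ne_zero_of_mul_eq_one (hU.mul_map u hu)
      have hy : g * u / H ≠ 0 := by positivity
      rw [← hU.map_eq_pow, he hu, map_div₀, map_add, map_add, hσy, hσv, hσw, e1 hy, e2 hy]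
      generalize g * u / H = y at *
      field_simp
    · have hσw : σ w = v := by rw [hvw, map_add, map_one, hσv]; grind
      rw [← hvw] at hσv
      refine ⟨w / v, div_ne_zero hw0 hv0, Or.inl fun z hz => ?_⟩
      obtain ⟨u, hu, rfl⟩ := Finset.mem_image.mp hz
      obtain ⟨h1, h2, hσy, -⟩ := hU.quotient_eq hH hg hvw hP hu
      have hu0 : u ≠ 0 := left_ne_zero_of_mul_eq_one (hU.mul_map u hu)
      have hy : g * u / H ≠ 0 := by positivity
      rw [← hU.map_eq_pow, he hu, map_div₀, map_add, map_add, hσy, hσv, hσw, e1 hy, e2 hy]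
      field_simp
  obtain ⟨ρ, hρ, hT⟩ := hT
  set k₀ := c + H * v + η * v ^ 2 with hk₀
  set k₂ := c + H * w + η * w ^ 2 with hk₂
  set l₀ := v ^ 2 * (c + H * w + θ * w ^ 2) with hl₀
  set l₂ := w ^ 2 * (c + H * v + θ * v ^ 2) with hl₂
  have hk (y : F) : c + H * y + η * y ^ 2 =
      k₀ * (y + w) ^ 2 + H * (y + v) * (y + w) + k₂ * (y + v) ^ 2 := by
    rw [hk₀, hk₂, hvw]
    grind
  have hl (y : F) : c * y ^ 2 + H * (v * w) * y + θ * (v * w) ^ 2 =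
      l₀ * (y + w) ^ 2 + H * (v * w) * (y + v) * (y + w) + l₂ * (y + v) ^ 2 := by
    rw [hl₀, hl₂, hvw]
    grind
  have h0 := hT.coeff_sq_eq hU.le_two_pow
    (by rw [Finset.card_image_of_injOn hinj]; exact hU.le_card) hne hρ
    (k₀ := k₀ * l₀ / H ^ 2) (k₁ := (k₀ * (v * w) + l₀) / H)
    (k₂ := (k₀ * l₂ + k₂ * l₀) / H ^ 2 + v * w) (k₃ := (k₂ * (v * w) + l₂) / H)
    (k₄ := k₂ * l₂ / H ^ 2) fun z hz => by
    obtain ⟨u, hu, rfl⟩ := Finset.mem_image.mp hz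
    obtain ⟨h1, h2, -, hφ⟩ := hU.quotient_eq hH hg hvw hP hu
    refine (Finset.sum_congr rfl fun i _ => ?_).trans (hU.trace_eq_zero u hu)
    rw [hφ, ← hη, ← hθ, hk, hl, he hu]
    congr 1
    generalize g * u / H = y at *
    generalize v * w = P at *
    field_simp
    ring
  simpa [div_pow, div_left_inj', hH] using h0

theorem sq_add_eq_zero [Finite F] (hU : GenericDirections m σ H g h c U) (hH : H ≠ 0)
    {v₀ : F} (hv₀ : v₀ ^ 2 + v₀ = g * σ g / H ^ 2) : σ g ^ 2 + σ h * H = 0 := by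
  have hg := hU.g_ne_zero hH
  have hσg : σ g ≠ 0 := (map_ne_zero σ).mpr hg
  set P := g * σ g / H ^ 2 with hP
  have hP0 : P ≠ 0 := by positivity
  set η := h * (H / g) ^ 2 with hη
  set θ := σ h * (H / σ g) ^ 2 with hθ
  have hση : σ η = θ := by
    rw [hη, map_mul, map_pow, map_div₀, hU.map_H]
  have hσθ : σ θ = η := by rw [← hση, hU.map_map]
  have hvw : v₀ * (v₀ + 1) = P := by rw [← hv₀]; ring
  have hηθ : η * θ * P ^ 2 = c * (H + c) + H ^ 2 * P := by
    have h1 := hU.norm_add_norm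
    have h2 : h * σ h = c * (H + c) + g * σ g := by rw [← h1]; grind
    rw [hη, hθ, hP]
    field_simp
    exact h2
  obtain ⟨h₀, h₁⟩ := hU.coeff_sq_eq hH hg rfl hvw hη hθ
  have hne : v₀ * (v₀ + 1) ≠ 0 := by rwa [hvw]
  rcases eta_dichotomy hH (left_ne_zero_of_mul hne) rfl (right_ne_zero_of_mul hne)
    (by rw [hvw]; exact hηθ) h₀ h₁ with h2 | ⟨hS, h2⟩
  · have h3 : θ = H := by rw [← hση, h2, hU.map_H]
    rw [hθ] at h3
    field_simp at h3
    rw [h3, CharTwo.add_self_eq_zero]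
  · exfalso
    rw [hvw] at h2
    have hS0 : η + θ ≠ 0 := fun h3 => hS (CharTwo.add_eq_zero.mp h3)
    obtain ⟨v, hv⟩ := FiniteField.isSquare_of_char_two (ringChar.eq F 2) ((η + H) / (η + θ))
    have hv2 : η = v ^ 2 * (η + θ) + H := by
      rw [sq, ← hv]
      field_simp
      grind
    have hσv : σ v = v + 1 := by
      have h3 : σ v ^ 2 = (v + 1) ^ 2 := by
        rw [CharTwo.add_sq, sq, sq, ← map_mul, ← hv, map_div₀, map_add, map_add, hση, hσθ, hU.map_H,
          add_comm θ η, one_pow, div_add_one hS0]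
        congr 1
        linear_combination -η * CharTwo.two_eq_zero (R := F)
      exact CharTwo.sq_inj.mp h3
    have hvP : v * (v + 1) = P := by
      have h3 : (η + H) * (θ + H) = P ^ 2 * (η + θ) ^ 2 := by
        refine mul_left_cancel₀ (pow_ne_zero 2 hP0) ?_
        linear_combination hηθ + H * h2 - (P ^ 2 * (η + θ) + c + H * P) * h2 +
          (c * H + H ^ 2 * P - c * H * P) * CharTwo.two_eq_zero (R := F)
      have h4 : v ^ 2 + 1 = (θ + H) / (η + θ) := by
        rw [sq, ← hv, div_add_one hS0]
        congr 1
        linear_combination η * CharTwo.two_eq_zero (R := F)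
      refine CharTwo.sq_inj.mp ?_
      rw [mul_pow, CharTwo.add_sq, one_pow, h4, sq v, ← hv, div_mul_div_comm, h3]
      field_simp
    refine hU.eq_zero_of_exceptional hH hg (v := v) (w := v + 1) (S := η + θ) rfl hvP hσv hv2 ?_ ?_
    · rw [← hθ]
      linear_combination hv2 - (η + v * (η + θ)) * CharTwo.two_eq_zero (R := F)
    · rw [hvP, h2]
      linear_combination -H * P * CharTwo.two_eq_zero (R := F)

end GenericDirections

section DegenerateDirection

variable {F : Type*} [Field F] [Fintype F] [CharP F 2]

omit [CharP F 2] in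
theorem exists_map_eq_self {q : ℕ} {σ : F →+* F} (hσ : ∀ x, σ x = x ^ q) (hq : 4 ≤ q)
    (hcard : Fintype.card F = q ^ 2) : ∃ t : F, σ t = t ∧ t ≠ 0 ∧ t ≠ 1 := by
  classical
  have hd : q - 1 ∣ Fintype.card F - 1 := by
    rw [hcard]
    simpa using Nat.sub_dvd_pow_sub_pow q 1 2
  have h1 : ({1} : Finset F).card < (Finset.univ.filter fun x : F => x ^ (q - 1) = 1).card := by
    rw [card_filter_pow_eq_one (by lia) hd, Finset.card_singleton]
    lia
  obtain ⟨t, ht, ht1⟩ := Finset.exists_mem_notMem_of_card_lt_card h1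
  have ht : t ^ (q - 1) = 1 := (Finset.mem_filter.mp ht).2
  refine ⟨t, ?_, ?_, by simpa using ht1⟩
  · rw [hσ, ← Nat.sub_add_cancel (by lia : 1 ≤ q), pow_succ, ht, one_mul]
  · rintro rfl
    rw [zero_pow (by lia)] at ht
    exact zero_ne_one ht

theorem IsAPN.dillon_degenerate {q : ℕ} {σ : F →+* F} {A C D : F} (hσ : ∀ x, σ x = x ^ q)
    (hσσ : ∀ x, σ (σ x) = x) (hq : 4 ≤ q) (hcard : Fintype.card F = q ^ 2)
    (hf : IsAPN (dillon q A 0 C D 0)) (hH : A * σ A + C * σ C + D * σ D + 1 = 0)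
    (hg : C + A * σ D = 0) : A * σ C + D = 0 := by
  by_contra hh
  have hC : C = A * σ D := CharTwo.add_eq_zero.mp hg
  have hσC : σ C = σ A * D := by rw [hC, map_mul, hσσ]
  have hD : D * σ D = 1 := by
    rw [hσC] at hh hH
    rw [hC] at hH
    have h1 : A * σ A + 1 ≠ 0 := fun h1 => hh (by linear_combination D * h1)
    have h2 : (A * σ A + 1) * (D * σ D + 1) = 0 := by linear_combination hH
    exact CharTwo.add_eq_zero.mp ((mul_eq_zero.mp h2).resolve_left h1)
  obtain ⟨u, hu⟩ := FiniteField.isSquare_of_char_two (ringChar.eq F 2) D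
  have hu1 : u * σ u = 1 := by
    refine CharTwo.sq_inj.mp ?_
    rw [one_pow, ← hD, hu, map_mul]
    ring
  obtain ⟨t, ht, ht0, ht1⟩ := exists_map_eq_self hσ hq hcard
  refine (hf.eq_zero_or_eq_one_of_dillon hσ hσσ hu1 ?_).elim ht0 ht1
  have h3 : C * u ^ 2 = A := by rw [hC, sq, ← hu, mul_assoc, mul_comm (σ D), hD, mul_one]
  rw [ht, h3, hu]
  grind

end DegenerateDirection

section Dichotomy

variable {F : Type*} [Field F] [Fintype F] [CharP F 2]

theorem IsAPN.dillon_dichotomy {m : ℕ} (hm : 16 ≤ 2 ^ m) {σ : F →+* F}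
    (hσ : ∀ x, σ x = x ^ (4 * 2 ^ m)) (hcard : Fintype.card F = (4 * 2 ^ m) ^ 2) {A C D H : F}
    (hf : IsAPN (dillon (4 * 2 ^ m) A 0 C D 0)) (hh : A * σ C + D ≠ 0)
    (hH : H = A * σ A + C * σ C + D * σ D + 1) :
    C + A * σ D ≠ 0 ∧
      (H = 0 → (σ A * C + σ D) * (C + A * σ D) ^ 2 = (A * σ C + D) * (σ C + D * σ A) ^ 2) ∧
      (H ≠ 0 → (C + A * σ D) ^ 2 + (A * σ C + D) * H = 0) := by
  have hσσ (x : F) : σ (σ x) = x := by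
    rw [hσ, hσ, ← pow_mul, ← sq, ← hcard, FiniteField.pow_card]
  have hσg : σ (σ C + D * σ A) = C + A * σ D := by
    simp only [map_add, map_mul, hσσ]
    ring
  have hσh : σ (σ A * C + σ D) = A * σ C + D := by simp only [map_add, map_mul, hσσ]
  have hh0 : σ A * C + σ D ≠ 0 := fun h0 => hh (by rw [← hσh, h0, map_zero])
  have hgH : σ C + D * σ A ≠ 0 ∨ H ≠ 0 := by
    by_contra! h0
    refine hh (hf.dillon_degenerate hσ hσσ (by lia) hcard (hH.symm.trans h0.2) ?_)
    rw [← hσg, h0.1, map_zero]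
  obtain ⟨U, hU⟩ := hf.exists_genericDirections hm hσ hcard hH rfl rfl rfl hh0 hgH
  have hg : σ C + D * σ A ≠ 0 := hgH.elim id hU.g_ne_zero
  refine ⟨?_, fun h0 => ?_, fun h0 => ?_⟩
  · rwa [← hσg, ne_eq, map_eq_zero]
  · rw [← hσg, ← hσh]
    exact CharTwo.add_eq_zero.mp (hU.h_mul_sq_add_eq_zero h0 hg)
  · have hfix : σ ((σ C + D * σ A) * σ (σ C + D * σ A) / H ^ 2) =
        (σ C + D * σ A) * σ (σ C + D * σ A) / H ^ 2 := by
      rw [map_div₀, map_mul, hσσ, map_pow, hU.map_H, mul_comm]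
    have hq : 4 * 2 ^ m = 2 ^ (m + 2) := by ring
    rw [hσ, hq] at hfix
    obtain ⟨v, hv⟩ := exists_sq_add_self_eq_of_pow_eq (by lia) (by rw [hcard, hq]) hfix
    rw [← hσg, ← hσh]
    refine hU.sq_add_eq_zero h0 (hv.trans ?_)
    rw [hσ, hq]

end Dichotomy

end Auxiliary

theorem statement9 :
    ∃ n₀ : ℕ, 0 < n₀ ∧ ∀ n : ℕ, n₀ ≤ n → ∀ q : ℕ, q = 2 ^ n →
      ∀ (F : Type) [Field F] [Fintype F], Fintype.card F = q ^ 2 →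
        ∀ A B C D E : F,
          ¬ CondC1 q A B C D E → ¬ CondC2 q A B C D E →
          B = 0 → E = 0 → A * C ^ q + D ≠ 0 →
          IsAPN (dillon q A B C D E) →
          (A ^ (q + 1) + C ^ (q + 1) + D ^ (q + 1) + 1 = 0 ∧
            (A * C ^ q + D) ^ (q - 1) = (A * D ^ q + C) ^ (2 * (q - 1))) ∨
          (A ^ (q + 1) + C ^ (q + 1) + D ^ (q + 1) + 1 ≠ 0 ∧ C ≠ A * D ^ q ∧
            (A ^ (q + 2) * C ^ q + A ^ 2 * D ^ (2 * q) + A ^ (q + 1) * D +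
              A * C ^ (2 * q + 1) + A * C ^ q * D ^ (q + 1) + A * C ^ q +
              C ^ 2 + C ^ (q + 1) * D + D ^ (q + 2) + D) *
            (A ^ (2 * q + 2) * C ^ (q + 1) +
              A ^ (q + 1) * (C ^ (q + 1) * D ^ (q + 1) + C ^ (q + 1) +
                D ^ (q + 1) + D ^ (2 * q + 2) + 1) +
              C ^ (3 * q + 3) + C ^ (2 * q + 2) + C ^ (q + 1) * D ^ (q + 1) +
              D ^ (3 * q + 3) + C ^ (2 * q + 2) * D ^ (q + 1) +
              C ^ (q + 1) * D ^ (2 * q + 2) +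
              ((A ^ (q + 2) * (C * D ^ (2 * q) + C ^ q * D ^ q) +
                  A ^ 2 * D ^ (3 * q) +
                  A * (C ^ (2 * q + 1) * D ^ q + C ^ (3 * q) +
                    C ^ q * D ^ (2 * q + 1) + C ^ q * D ^ q) +
                  C ^ 2 * D ^ q) +
                (A ^ (q + 2) * (C * D ^ (2 * q) + C ^ q * D ^ q) +
                  A ^ 2 * D ^ (3 * q) +
                  A * (C ^ (2 * q + 1) * D ^ q + C ^ (3 * q) +
                    C ^ q * D ^ (2 * q + 1) + C ^ q * D ^ q) +
                  C ^ 2 * D ^ q) ^ q)) = 0) := by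
  refine ⟨6, by norm_num, ?_⟩
  rintro n hn q hq F _ _ hcard A B C D E - - rfl rfl hh hf
  obtain ⟨m, rfl⟩ := Nat.exists_eq_add_of_le' (by lia : 2 ≤ n)
  have hm : 16 ≤ 2 ^ m := (by norm_num : 16 = 2 ^ 4) ▸ Nat.pow_le_pow_right two_pos (by lia)
  have : CharP F 2 := charP_of_card_eq_prime_pow (f := (m + 2) * 2) (by rw [hcard, hq, pow_mul])
  obtain ⟨σ, hσ⟩ : ∃ σ : F →+* F, ∀ x, σ x = x ^ q :=
    ⟨iterateFrobenius F 2 (m + 2), fun x => by rw [iterateFrobenius_def, hq]⟩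
  have hσσ (x : F) : σ (σ x) = x := by
    rw [hσ, hσ, ← pow_mul, ← sq, ← hcard, FiniteField.pow_card]
  have hq1 : q = q - 1 + 1 := by
    rw [Nat.sub_add_cancel]
    exact hq ▸ Nat.one_le_two_pow
  have hh' : A * σ C + D ≠ 0 := by rwa [hσ]
  obtain ⟨hg, h0, h1⟩ : _ ∧ _ ∧ _ := by
    obtain rfl : q = 4 * 2 ^ m := by rw [hq, pow_add, mul_comm]; rfl
    exact hf.dillon_dichotomy hm hσ hcard hh' rfl
  have hH : A ^ (q + 1) + C ^ (q + 1) + D ^ (q + 1) + 1 =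
      A * σ A + C * σ C + D * σ D + 1 := by
    simp only [hσ]
    ring
  rw [hH]
  by_cases hH0 : A * σ A + C * σ C + D * σ D + 1 = 0
  · refine Or.inl ⟨hH0, ?_⟩
    rw [← hσ, ← hσ, add_comm _ C, pow_mul']
    have h2 : σ A * C + σ D = (A * σ C + D) ^ (q - 1) * (A * σ C + D) := by
      rw [← pow_succ, ← hq1, ← hσ]
      simp only [map_add, map_mul, hσσ]
    have h3 : σ C + D * σ A = (C + A * σ D) ^ (q - 1) * (C + A * σ D) := by
      rw [← pow_succ, ← hq1, ← hσ]
      simp only [map_add, map_mul, hσσ]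
      ring
    have h4 := h0 hH0
    rw [h2, h3] at h4
    exact mul_right_cancel₀ (mul_ne_zero hh' (pow_ne_zero 2 hg)) (by linear_combination h4)
  · refine Or.inr ⟨hH0, fun hC => hg ?_, mul_eq_zero_of_left ?_ _⟩
    · rw [hσ, ← hC, CharTwo.add_self_eq_zero]
    · have h2 := h1 hH0
      simp only [hσ] at h2
      linear_combination h2 - A * C * D ^ q * CharTwo.two_eq_zero (R := F)
end
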